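/- arXiv:1707.02728 — 7 statements merged into one kernel-verified Lean document; each statement's English description precedes it below -/
import Mathlib

section
/- Let X be a finite simple graph on n ≥ 1 vertices with adjacency matrix A (over ℂ), and let J denote the n×n all-ones matrix. Then X is connected and regular (of some degree k) if and only if there exists a polynomial p with complex coefficients such that p(A) = J. -/
open Polynomial in
theorem Matrix.aeval_mul_eq_eval_smul {n R : Type*} [Fintype n] [DecidableEq n] [CommRing R]
    {A B : Matrix n n R} {c : R} (h : A * B = c • B) (p : R[X]) :
    aeval A p * B = p.eval c • B := by
  induction p using Polynomial.induction_on' with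
  | add p q hp hq => simp [add_mul, add_smul, hp, hq]
  | monomial k a =>
    have hk : A ^ k * B = c ^ k • B := by
      induction k with
      | zero => simp
      | succ k ih => rw [pow_succ, mul_assoc, h, mul_smul_comm, ih, smul_smul, pow_succ']
    rw [aeval_monomial, eval_monomial, mul_assoc, hk, ← Algebra.smul_def, smul_smul]

open Polynomial in
theorem Matrix.IsSymm.aeval {n R : Type*} [Fintype n] [DecidableEq n] [CommRing R]
    {A : Matrix n n R} (h : A.IsSymm) (p : R[X]) : (aeval A p).IsSymm := by
  induction p using Polynomial.induction_on' with
  | add p q hp hq => simpa using hp.add hq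
  | monomial k a =>
    rw [aeval_monomial, ← Algebra.smul_def]
    exact (h.pow k).smul a

namespace SimpleGraph

open scoped Matrix

variable {V : Type*} [Fintype V] (X : SimpleGraph V) [DecidableRel X.Adj]

theorem adjMatrix_mul_of_one_apply (R : Type*) [NonAssocSemiring R] (u v : V) :
    (X.adjMatrix R * (Matrix.of fun _ _ => (1 : R) : Matrix V V R)) u v = X.degree u := by
  simp

theorem of_one_mul_adjMatrix_apply (R : Type*) [NonAssocSemiring R] (u v : V) :
    ((Matrix.of fun _ _ => (1 : R) : Matrix V V R) * X.adjMatrix R) u v = X.degree v := by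
  simp

variable {X} [DecidableEq V]

theorem Connected.eq_of_adjMatrix_mulVec_eq_smul (hX : X.Connected) {k : ℕ}
    (hk : X.IsRegularOfDegree k) {x : V → ℝ} (hx : X.adjMatrix ℝ *ᵥ x = (k : ℝ) • x) (u v : V) :
    x u = x v := by
  refine (X.lapMatrix_mulVec_eq_zero_iff_forall_reachable).1 ?_ u v (hX.preconnected u v)
  ext w
  have hw := congrFun hx w
  simp only [Pi.smul_apply, smul_eq_mul] at hw
  simp [lapMatrix, Matrix.sub_mulVec, degMatrix, Matrix.mulVec_diagonal, hk w, hw]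

open Polynomial in
theorem Connected.exists_aeval_adjMatrix_eq_of_one [Nonempty V] (hX : X.Connected) {k : ℕ}
    (hk : X.IsRegularOfDegree k) :
    ∃ p : ℝ[X], aeval (X.adjMatrix ℝ) p = Matrix.of fun _ _ => (1 : ℝ) := by
  set A := X.adjMatrix ℝ with hA
  have hint : IsIntegral ℝ A := Matrix.isIntegral A
  have hAJ : A * (Matrix.of fun _ _ => (1 : ℝ) : Matrix V V ℝ) =
      (k : ℝ) • (Matrix.of fun _ _ => (1 : ℝ) : Matrix V V ℝ) := by
    ext u v
    rw [hA, adjMatrix_mul_of_one_apply, hk u]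
    simp
  have hroot : (minpoly ℝ A).IsRoot k := by
    have h := Matrix.aeval_mul_eq_eval_smul hAJ (minpoly ℝ A)
    rw [minpoly.aeval, zero_mul] at h
    obtain ⟨v⟩ := ‹Nonempty V›
    simpa using (congrFun (congrFun h v) v).symm
  obtain ⟨q, hq⟩ := dvd_iff_isRoot.2 hroot
  have hm0 := minpoly.ne_zero hint
  have hq0 : q ≠ 0 := by
    rintro rfl
    exact hm0 (by simpa using hq)
  have hne : aeval A q ≠ 0 := by
    intro h
    have hle := minpoly.degree_le_of_ne_zero ℝ A hq0 h
    rw [hq, degree_mul, degree_X_sub_C, degree_eq_natDegree hq0] at hle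
    norm_cast at hle
    omega
  have hmul : A * aeval A q = (k : ℝ) • aeval A q := by
    have h := minpoly.aeval ℝ A
    rw [hq, map_mul, map_sub, aeval_X, aeval_C, sub_mul, ← Algebra.smul_def] at h
    exact sub_eq_zero.1 h
  have hcol (u u' v : V) : aeval A q u v = aeval A q u' v := by
    refine hX.eq_of_adjMatrix_mulVec_eq_smul hk (x := fun w => aeval A q w v) ?_ u u'
    ext w
    exact congrFun (congrFun hmul w) v
  have hsymm : (aeval A q).IsSymm := (X.isSymm_adjMatrix).aeval q
  obtain ⟨v₀⟩ := ‹Nonempty V›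
  have hconst (u v : V) : aeval A q u v = aeval A q v₀ v₀ := by
    rw [hcol u v₀ v, ← hsymm.apply, hcol v v₀ v₀]
  have hc : aeval A q v₀ v₀ ≠ 0 := fun h => hne (by ext u v; simp [hconst u v, h])
  refine ⟨C (aeval A q v₀ v₀)⁻¹ * q, ?_⟩
  ext u v
  rw [map_mul, aeval_C, ← Algebra.smul_def, Matrix.smul_apply, hconst u v]
  simp [hc]

open Polynomial in
theorem aeval_adjMatrix_apply_eq_zero_of_not_reachable {R : Type*} [CommRing R] {u v : V}
    (h : ¬ X.Reachable u v) (p : R[X]) : aeval (X.adjMatrix R) p u v = 0 := by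
  have : IsEmpty (X.Walk u v) := not_nonempty_iff.1 h
  induction p using Polynomial.induction_on' with
  | add p q hp hq => simp [hp, hq]
  | monomial k a =>
    rw [aeval_monomial, ← Algebra.smul_def, Matrix.smul_apply, adjMatrix_pow_apply_eq_card_walk]
    simp [Set.eq_empty_of_isEmpty]

end SimpleGraph


/-- **Hoffman's theorem.** A finite simple graph `X` on `n ≥ 1` vertices is connected and
regular (of some degree `k`) if and only if the all-ones matrix `J` is a polynomial in the
adjacency matrix of `X` over `ℂ`. -/
theorem hoffman_connected_regular_iff_J_in_adjacency_algebra
    {V : Type*} [Fintype V] [DecidableEq V] [Nonempty V]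
    (X : SimpleGraph V) [DecidableRel X.Adj] :
    (X.Connected ∧ ∃ k : ℕ, X.IsRegularOfDegree k) ↔
      ∃ p : Polynomial ℂ,
        Polynomial.aeval (X.adjMatrix ℂ) p = Matrix.of (fun _ _ => (1 : ℂ)) := by
  constructor
  · rintro ⟨hX, k, hk⟩
    obtain ⟨p, hp⟩ := hX.exists_aeval_adjMatrix_eq_of_one hk
    refine ⟨p.map (algebraMap ℝ ℂ), ?_⟩
    have hA : X.adjMatrix ℂ = (Algebra.ofId ℝ ℂ).mapMatrix (X.adjMatrix ℝ) := by
      ext u v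
      by_cases h : X.Adj u v <;> simp [h]
    rw [Polynomial.aeval_map_algebraMap, hA, Polynomial.aeval_algHom_apply, hp]
    ext u v
    simp
  · rintro ⟨p, hp⟩
    refine ⟨⟨fun u v => ?_⟩, ?_⟩
    · by_contra h
      have h0 := SimpleGraph.aeval_adjMatrix_apply_eq_zero_of_not_reachable h p
      simp [hp] at h0
    · obtain ⟨v⟩ := ‹Nonempty V›
      refine ⟨X.degree v, fun u => ?_⟩
      have hcomm : Commute (X.adjMatrix ℂ) (Matrix.of fun _ _ => (1 : ℂ)) := by
        rw [← hp]
        simpa using (Commute.all Polynomial.X p).map (Polynomial.aeval (X.adjMatrix ℂ))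
      have h := congrFun (congrFun hcomm.eq u) v
      rw [X.adjMatrix_mul_of_one_apply, X.of_one_mul_adjMatrix_apply] at h
      exact_mod_cast h
end

section
/- Let n be a positive integer and m a natural number, and set g = gcd(m, n). Then the Ramanujan sum satisfies c_n(m) = μ(n/g) · φ(n)/φ(n/g), where μ is the Möbius function and φ is Euler's totient function. In particular, for any divisor d of n, c_n(m) = c_n(d) for every m with gcd(m, n) = d. -/
/-- The Ramanujan sum `c_n(m) = ∑_{1 ≤ k ≤ n, gcd(k,n)=1} e^{2πikm/n}`. -/
noncomputable def ramanujanSum (n m : ℕ) : ℂ :=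
  ∑ k ∈ (Finset.Icc 1 n).filter (fun k => Nat.Coprime k n),
    Complex.exp (2 * Real.pi * Complex.I * k * m / n)

open Finset ArithmeticFunction

/-- The sum of all `n`-th roots of unity vanishes unless `n = 1`. -/
theorem IsPrimitiveRoot.sum_nthRootsFinset {R : Type*} [CommRing R] [IsDomain R] {ζ : R} {n : ℕ}
    (hζ : IsPrimitiveRoot ζ n) (hn : 0 < n) :
    ∑ z ∈ Polynomial.nthRootsFinset n (1 : R), z = if n = 1 then 1 else 0 := by
  have : NeZero n := ⟨hn.ne'⟩
  have h : ∑ i ∈ range n, ζ ^ i = ∑ z ∈ Polynomial.nthRootsFinset n (1 : R), z := by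
    refine sum_bij (fun i _ => ζ ^ i) (fun i _ => ?_) (fun i hi j hj hij => ?_)
      (fun z hz => ?_) (fun _ _ => rfl)
    · rw [Polynomial.mem_nthRootsFinset hn, pow_right_comm, hζ.pow_eq_one, one_pow]
    · exact hζ.pow_inj (mem_range.1 hi) (mem_range.1 hj) hij
    · obtain ⟨i, hi, rfl⟩ := hζ.eq_pow_of_pow_eq_one ((Polynomial.mem_nthRootsFinset hn _).1 hz)
      exact ⟨i, mem_range.2 hi, rfl⟩
  rw [← h]
  split_ifs with h1
  · simp [h1]
  · exact hζ.geom_sum_eq_zero (by lia)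

/-- The sum of the primitive `n`-th roots of unity is `μ n`. -/
theorem Complex.sum_primitiveRoots {n : ℕ} (hn : 0 < n) :
    ∑ z ∈ primitiveRoots n ℂ, z = (moebius n : ℂ) := by
  have key : ∀ k > 0, ∑ d ∈ k.divisors, ∑ z ∈ primitiveRoots d ℂ, z =
      if k = 1 then (1 : ℂ) else 0 := by
    intro k hk
    rw [← (Complex.isPrimitiveRoot_exp k hk.ne').sum_nthRootsFinset hk,
      IsPrimitiveRoot.nthRoots_one_eq_biUnion_primitiveRoots,
      sum_biUnion fun _ _ _ _ h => IsPrimitiveRoot.disjoint h]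
  rw [← sum_eq_iff_sum_mul_moebius_eq.1 key n hn, sum_eq_single (n, 1)]
  · simp
  · rintro ⟨a, b⟩ hab hne
    have hb : b ≠ 1 := by
      rintro rfl
      simp_all [Nat.mem_divisorsAntidiagonal]
    simp [hb]
  · simp [hn.ne']

/-- The sum over a complete set of residues coprime to `n` as a sum over `(ZMod n)ˣ`. -/
theorem ZMod.sum_filter_coprime_Icc_eq_sum_units {M : Type*} [AddCommMonoid M] {n : ℕ} [NeZero n]
    (f : ZMod n → M) :
    ∑ k ∈ (Icc 1 n).filter (fun k => Nat.Coprime k n), f k = ∑ u : (ZMod n)ˣ, f u := by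
  refine sum_bij (fun k hk => ZMod.unitOfCoprime k (mem_filter.1 hk).2) (fun _ _ => mem_univ _)
    (fun a ha b hb hab => ?_) (fun u _ => ?_) (fun k hk => by simp)
  · have h := congrArg Units.val hab
    simp only [ZMod.coe_unitOfCoprime, ZMod.natCast_eq_natCast_iff] at h
    simp only [mem_filter, mem_Icc] at ha hb
    refine h.eq_of_abs_lt ?_
    rw [abs_lt]
    lia
  · have hn := NeZero.pos n
    have hu := ZMod.val_coe_unit_coprime u
    have hlt := ZMod.val_lt (u : ZMod n)
    rcases Nat.eq_zero_or_pos (u : ZMod n).val with h0 | h0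
    · have h1 : n = 1 := by simpa [h0] using hu
      subst h1
      exact ⟨1, by simp, Subsingleton.elim _ _⟩
    · exact ⟨(u : ZMod n).val, mem_filter.2 ⟨mem_Icc.2 ⟨h0, hlt.le⟩, hu⟩, Units.ext (by simp)⟩

/-- Summing a function over the domain of a surjective homomorphism of finite groups. -/
theorem MonoidHom.card_mul_sum_comp {G H R : Type*} [Group G] [Group H] [Fintype G] [Fintype H]
    [CommSemiring R] (f : G →* H) (hf : Function.Surjective f) (F : H → R) :
    (Fintype.card H : R) * ∑ g, F (f g) = Fintype.card G * ∑ h, F h := by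
  classical
  have fiber (h : H) : #{g | f g = h} = #{g | f g = 1} :=
    MonoidHom.card_fiber_eq_of_mem_range f (hf h) (hf 1)
  have hcard : Fintype.card G = Fintype.card H * #{g | f g = 1} := by
    rw [← card_univ, card_eq_sum_card_fiberwise (f := f) (t := univ) (by simp)]
    simp [fiber]
  have hsum : ∑ g, F (f g) = #{g | f g = 1} * ∑ h, F h := by
    rw [← sum_fiberwise univ f, mul_sum]
    refine sum_congr rfl fun h _ => ?_
    rw [sum_congr rfl (g := fun _ => F h) (by simp +contextual), sum_const, fiber, nsmul_eq_mul]
  rw [hsum, hcard, Nat.cast_mul, mul_assoc]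

/-- Summing `ζ ^ u` over the units modulo `n` gives the sum of all primitive `n`-th roots of unity. -/
theorem IsPrimitiveRoot.sum_units_pow_val {R : Type*} [CommRing R] [IsDomain R] {ζ : R} {n : ℕ}
    [NeZero n] (hζ : IsPrimitiveRoot ζ n) :
    ∑ u : (ZMod n)ˣ, ζ ^ (u : ZMod n).val = ∑ z ∈ primitiveRoots n R, z := by
  have hn := NeZero.pos n
  refine sum_bij (fun u _ => ζ ^ (u : ZMod n).val) (fun u _ => ?_) (fun u _ v _ huv => ?_)
    (fun z hz => ?_) (fun _ _ => rfl)
  · exact (mem_primitiveRoots hn).2 (hζ.pow_of_coprime _ (ZMod.val_coe_unit_coprime u))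
  · exact Units.ext (ZMod.val_injective n (hζ.pow_inj (ZMod.val_lt _) (ZMod.val_lt _) huv))
  · obtain ⟨i, hi, hic, rfl⟩ := hζ.isPrimitiveRoot_iff.1 ((mem_primitiveRoots hn).1 hz)
    exact ⟨ZMod.unitOfCoprime i hic, mem_univ _, by simp [ZMod.val_natCast_of_lt hi]⟩

/-- Hölder's formula for the Ramanujan sum. -/
theorem ramanujanSum_eq (n : ℕ) (hn : 0 < n) (m : ℕ) :
    ramanujanSum n m =
      (moebius (n / Nat.gcd m n) : ℂ) *
        (Nat.totient n : ℂ) / (Nat.totient (n / Nat.gcd m n) : ℂ) := by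
  set N := n / Nat.gcd m n with hN
  have hdvd : N ∣ n := Nat.div_dvd_of_dvd (Nat.gcd_dvd_right m n)
  have hg : 0 < Nat.gcd m n := Nat.gcd_pos_of_pos_right m hn
  have hNpos : 0 < N := Nat.pos_of_dvd_of_pos hdvd hn
  have : NeZero n := ⟨hn.ne'⟩
  have : NeZero N := ⟨hNpos.ne'⟩
  have hω := Complex.isPrimitiveRoot_exp_of_coprime (m / Nat.gcd m n) N hNpos.ne'
    (Nat.coprime_div_gcd_div_gcd hg)
  set ω := Complex.exp (2 * Real.pi * Complex.I * ((m / Nat.gcd m n : ℕ) / N)) with hωdef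
  have hquot : ((m / Nat.gcd m n : ℕ) / N : ℂ) = m / n := by
    have hg' : (Nat.gcd m n : ℂ) ≠ 0 := by exact_mod_cast hg.ne'
    rw [hN, Nat.cast_div (Nat.gcd_dvd_left m n) hg', Nat.cast_div (Nat.gcd_dvd_right m n) hg',
      div_div_div_cancel_right₀ hg']
  have hsum : ramanujanSum n m = ∑ u : (ZMod n)ˣ, ω ^ (ZMod.unitsMap hdvd u : ZMod N).val := by
    simp only [ZMod.unitsMap_def, Units.coe_map, MonoidHom.coe_coe]
    rw [← ZMod.sum_filter_coprime_Icc_eq_sum_units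
      (fun x => ω ^ (ZMod.castHom hdvd (ZMod N) x).val), ramanujanSum]
    refine sum_congr rfl fun k _ => ?_
    rw [map_natCast, ZMod.val_natCast, hω.eq_orderOf, pow_mod_orderOf, hωdef, hquot,
      ← Complex.exp_nat_mul]
    congr 1
    ring
  have hmul := MonoidHom.card_mul_sum_comp (ZMod.unitsMap hdvd) (ZMod.unitsMap_surjective hdvd)
    (fun v => ω ^ (v : ZMod N).val)
  rw [← hsum, hω.sum_units_pow_val, Complex.sum_primitiveRoots hNpos,
    ZMod.card_units_eq_totient, ZMod.card_units_eq_totient] at hmul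
  have hφ : (Nat.totient N : ℂ) ≠ 0 := by exact_mod_cast (Nat.totient_pos.2 hNpos).ne'
  rw [eq_div_iff hφ, mul_comm, hmul, mul_comm]

/-- Hölder's evaluation of the Ramanujan sum: with `g = gcd(m, n)`,
`c_n(m) = μ(n/g) · φ(n)/φ(n/g)`. In particular, if `d ∣ n` then `c_n(m) = c_n(d)`
for every `m` with `gcd(m, n) = d`. -/
theorem ramanujanSum_eq_moebius_mul_totient_div_totient (n : ℕ) (hn : 0 < n) (m : ℕ) :
    (ramanujanSum n m =
      (ArithmeticFunction.moebius (n / Nat.gcd m n) : ℂ) *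
        (Nat.totient n : ℂ) / (Nat.totient (n / Nat.gcd m n) : ℂ)) ∧
    (∀ d : ℕ, d ∣ n → ∀ m' : ℕ, Nat.gcd m' n = d → ramanujanSum n m' = ramanujanSum n d) := by
  refine ⟨ramanujanSum_eq n hn m, fun d hd m' hm' => ?_⟩
  rw [ramanujanSum_eq n hn m', ramanujanSum_eq n hn d, hm', Nat.gcd_eq_left hd]
end

section
/- Let n ≥ 2 be an integer. The adjacency matrix of the unitary Cayley graph X_n is non-singular (has nonzero determinant) if and only if n is squarefree. -/
open Classical in
/-- The adjacency matrix (over `ℂ`) of the unitary Cayley graph `X_n`: vertices are `ℤ/nℤ`,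
and distinct `x, y` are adjacent iff `x - y` is a unit of `ℤ/nℤ`. -/
noncomputable def ucgAdjMatrix (n : ℕ) [NeZero n] : Matrix (ZMod n) (ZMod n) ℂ :=
  Matrix.of (fun x y : ZMod n => if x ≠ y ∧ IsUnit (x - y) then (1 : ℂ) else 0)

open Classical in
/-- The matrix over `ℂ`, indexed by a ring `R`, with entry `1` where `x - y` is a unit and `0`
elsewhere. -/
noncomputable def unitDiffMatrix (R : Type*) [Ring R] : Matrix R R ℂ :=
  Matrix.of (fun x y : R => if IsUnit (x - y) then (1 : ℂ) else 0)

theorem ucgAdjMatrix_eq_unitDiffMatrix (n : ℕ) [NeZero n] (hn : 2 ≤ n) :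
    ucgAdjMatrix n = unitDiffMatrix (ZMod n) := by
  have : Fact (1 < n) := ⟨hn⟩
  ext x y
  by_cases h : x = y <;> simp [ucgAdjMatrix, unitDiffMatrix, h]

open scoped Kronecker in
theorem unitDiffMatrix_prod (R S : Type*) [Ring R] [Ring S] :
    unitDiffMatrix (R × S) = unitDiffMatrix R ⊗ₖ unitDiffMatrix S := by
  ext x y
  have hunit : IsUnit (x - y) ↔ IsUnit (x.1 - y.1) ∧ IsUnit (x.2 - y.2) := Prod.isUnit_iff
  by_cases h₁ : IsUnit (x.1 - y.1) <;> by_cases h₂ : IsUnit (x.2 - y.2) <;>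
    simp [unitDiffMatrix, Matrix.kroneckerMap_apply, hunit, h₁, h₂]

theorem unitDiffMatrix_submatrix_ringEquiv {R S : Type*} [Ring R] [Ring S] (e : R ≃+* S) :
    (unitDiffMatrix S).submatrix e e = unitDiffMatrix R := by
  ext x y
  have hunit : IsUnit (e x - e y) ↔ IsUnit (x - y) := by
    rw [← map_sub, MulEquiv.isUnit_map]
  by_cases h : IsUnit (x - y) <;> simp [unitDiffMatrix, hunit, h]

theorem det_unitDiffMatrix_congr {R S : Type*} [Ring R] [Ring S] [Fintype R] [Fintype S]
    [DecidableEq R] [DecidableEq S] (e : R ≃+* S) :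
    (unitDiffMatrix R).det = (unitDiffMatrix S).det := by
  rw [← unitDiffMatrix_submatrix_ringEquiv e]
  exact Matrix.det_submatrix_equiv_self e.toEquiv _

theorem det_unitDiffMatrix_prod (R S : Type*) [Ring R] [Ring S] [Fintype R] [Fintype S]
    [DecidableEq R] [DecidableEq S] :
    (unitDiffMatrix (R × S)).det =
      (unitDiffMatrix R).det ^ Fintype.card S * (unitDiffMatrix S).det ^ Fintype.card R := by
  rw [unitDiffMatrix_prod, Matrix.det_kronecker]

theorem det_unitDiffMatrix_ne_zero_of_field (K : Type*) [Field K] [Fintype K] [DecidableEq K] :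
    (unitDiffMatrix K).det ≠ 0 := by
  intro h
  obtain ⟨v, hv, hMv⟩ := Matrix.exists_mulVec_eq_zero_iff.mpr h
  have hsum (x : K) : ∑ y, v y = v x := by
    have hx := congrFun hMv x
    have hentry (y : K) : unitDiffMatrix K x y * v y = v y - if x = y then v y else 0 := by
      by_cases hxy : x = y <;> simp [unitDiffMatrix, hxy, sub_eq_zero]
    simpa [Matrix.mulVec, dotProduct, hentry, sub_eq_zero] using hx
  have hcard : (Fintype.card K : ℂ) * ∑ y, v y = ∑ y, v y := by
    conv_rhs => rw [← Finset.sum_congr rfl fun x _ => hsum x]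
    simp
  have hzero : ∑ y, v y = 0 := by
    by_contra hne
    have hone : (Fintype.card K : ℂ) = 1 := by simpa [hne] using hcard
    exact Fintype.one_lt_card (α := K) |>.ne' (by exact_mod_cast hone)
  exact hv (funext fun x => by rw [← hsum x, hzero, Pi.zero_apply])

theorem det_unitDiffMatrix_eq_zero_of_not_isReduced (R : Type*) [CommRing R] [Fintype R]
    [DecidableEq R] (h : ¬ IsReduced R) : (unitDiffMatrix R).det = 0 := by
  obtain ⟨t, ht, ht0⟩ : ∃ t : R, IsNilpotent t ∧ t ≠ 0 := by
    by_contra! hall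
    exact h ⟨hall⟩
  refine Matrix.det_zero_of_row_eq ht0 (funext fun y => ?_)
  have hunit : IsUnit (t - y) ↔ IsUnit (0 - y) := by
    refine ⟨fun hu => ?_, fun hu => ?_⟩
    · simpa [sub_eq_add_neg] using ht.neg.isUnit_add_left_of_commute hu (Commute.all _ _)
    · simpa [sub_eq_add_neg, add_comm] using ht.isUnit_add_left_of_commute hu (Commute.all _ _)
  simp [unitDiffMatrix, hunit]

theorem det_unitDiffMatrix_zmod_ne_zero (n : ℕ) [NeZero n] (hn : Squarefree n) :
    (unitDiffMatrix (ZMod n)).det ≠ 0 := by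
  revert hn ‹NeZero n›
  induction n using Nat.recOnPrimeCoprime with
  | zero => exact fun {h} => absurd rfl h.out
  | prime_pow p k hp =>
    intro _ hn
    have : Fact p.Prime := ⟨hp⟩
    obtain rfl | hk := eq_or_ne k 0
    · have : Subsingleton (ZMod (p ^ 0)) := by rw [pow_zero]; infer_instance
      rw [Matrix.det_eq_elem_of_subsingleton _ 0, unitDiffMatrix, Matrix.of_apply,
        if_pos (isUnit_of_subsingleton _)]
      exact one_ne_zero
    · obtain rfl : k = 1 := (Nat.squarefree_pow_iff hp.ne_one hk).mp hn |>.2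
      rw [det_unitDiffMatrix_congr (ZMod.ringEquivCongr (pow_one p))]
      exact det_unitDiffMatrix_ne_zero_of_field (ZMod p)
  | coprime a b ha hb hab iha ihb =>
    intro _ hn
    have : NeZero a := ⟨by omega⟩
    have : NeZero b := ⟨by omega⟩
    rw [det_unitDiffMatrix_congr (ZMod.chineseRemainder hab), det_unitDiffMatrix_prod]
    exact mul_ne_zero (pow_ne_zero _ (iha hn.of_mul_left)) (pow_ne_zero _ (ihb hn.of_mul_right))

/-- The unitary Cayley graph `X_n` is non-singular iff `n` is squarefree. -/
theorem ucg_nonsingular_iff_squarefree (n : ℕ) [NeZero n] (hn : 2 ≤ n) :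
    (ucgAdjMatrix n).det ≠ 0 ↔ Squarefree n := by
  rw [ucgAdjMatrix_eq_unitDiffMatrix n hn]
  refine ⟨fun h => ?_, det_unitDiffMatrix_zmod_ne_zero n⟩
  by_contra hsq
  refine h (det_unitDiffMatrix_eq_zero_of_not_isReduced _ fun hred => hsq ?_)
  exact (isReduced_zmod.mp hred).resolve_right (NeZero.ne n)
end

section
/- Let n be a positive integer and let R_n(x) = ∑_{m=0}^{n−1} c_n(m) x^m, where c_n(m) is the Ramanujan sum. Then the number of indices m ∈ {0, 1, …, n−1} with c_n(m) ≠ 0 equals γ(n), and the degree of R_n(x) equals n − n/γ(n). -/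
/-- The radical (squarefree part) `γ(n) = ∏_{p ∣ n} p` of `n`. -/
def rad (n : ℕ) : ℕ := ∏ p ∈ n.primeFactors, p

open ArithmeticFunction in
theorem sum_moebius_divisors_filter_dvd (k : ℕ) {r : ℕ} (hr : r ≠ 0) :
    ∑ d ∈ r.divisors.filter (· ∣ k), moebius d = if Nat.Coprime k r then 1 else 0 := by
  have hfilter : r.divisors.filter (· ∣ k) = (Nat.gcd k r).divisors := by
    ext d
    simp [Nat.dvd_gcd_iff, hr, and_comm]
  rw [hfilter, ← coe_zeta_mul_apply, coe_zeta_mul_moebius, one_apply]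

open ArithmeticFunction in
theorem sum_moebius_mul_divisors_eq_totient {g : ℕ} (hg : 0 < g) :
    ∑ e ∈ g.divisors, moebius (g / e) * (e : ℤ) = Nat.totient g := by
  have h := (sum_eq_iff_sum_mul_moebius_eq (R := ℤ) (f := fun n => (Nat.totient n : ℤ))
    (g := fun n => (n : ℤ))).1 (fun n _ => by exact_mod_cast Nat.sum_totient n) g hg
  simp only [Int.cast_id] at h
  rw [← h, Nat.sum_divisorsAntidiagonal' (fun a b => moebius a * (b : ℤ))]

open ArithmeticFunction in
/-- For squarefree `r`, the Möbius form of the Ramanujan sum `c_r(j)` does not vanish. -/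
theorem sum_moebius_mul_ite_dvd_ne_zero {r : ℕ} (hr : Squarefree r) (j : ℕ) :
    ∑ e ∈ r.divisors, moebius (r / e) * (if e ∣ j then (e : ℤ) else 0) ≠ 0 := by
  have hr0 : r ≠ 0 := hr.ne_zero
  have hg : 0 < Nat.gcd r j := Nat.gcd_pos_of_pos_left _ (Nat.pos_of_ne_zero hr0)
  obtain ⟨s, hs⟩ := Nat.gcd_dvd_left r j
  set g := Nat.gcd r j with hgdef
  have hfilter : r.divisors.filter (· ∣ j) = g.divisors := by
    ext d
    simp [hgdef, Nat.dvd_gcd_iff, hr0]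
  have hsum : ∑ e ∈ r.divisors, moebius (r / e) * (if e ∣ j then (e : ℤ) else 0) =
      moebius s * Nat.totient g := by
    rw [← sum_moebius_mul_divisors_eq_totient hg, Finset.mul_sum, ← hfilter, Finset.sum_filter]
    refine Finset.sum_congr rfl fun e he => ?_
    split_ifs with hej
    · have heg : e ∣ g := Nat.dvd_gcd (Nat.dvd_of_mem_divisors he) hej
      have hdiv : r / e = s * (g / e) := by
        rw [hs, mul_comm, Nat.mul_div_assoc _ heg]
      have hcop : Nat.Coprime s (g / e) :=
        Nat.coprime_of_squarefree_mul
          (hr.squarefree_of_dvd ⟨e, by rw [mul_assoc, Nat.div_mul_cancel heg, mul_comm, ← hs]⟩)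
      rw [hdiv, isMultiplicative_moebius.map_mul_of_coprime hcop, mul_assoc]
    · simp
  rw [hsum]
  refine mul_ne_zero (moebius_ne_zero_iff_squarefree.2 (hr.squarefree_of_dvd ⟨g, ?_⟩)) ?_
  · rw [mul_comm, ← hs]
  · exact_mod_cast (Nat.totient_pos.2 hg).ne'

theorem IsPrimitiveRoot.sum_pow_mul_filter_dvd {w : ℂ} {n d : ℕ} (hw : IsPrimitiveRoot w n)
    (hn : 0 < n) (hd : d ∣ n) (m : ℕ) :
    ∑ k ∈ (Finset.Icc 1 n).filter (d ∣ ·), w ^ (k * m) =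
      if n / d ∣ m then ((n / d : ℕ) : ℂ) else 0 := by
  obtain ⟨N, rfl⟩ := hd
  have hd0 : 0 < d := Nat.pos_of_mul_pos_right hn
  have hw' : IsPrimitiveRoot (w ^ d) N := hw.pow hn rfl
  rw [Nat.mul_div_cancel_left _ hd0]
  have himage : (Finset.Icc 1 (d * N)).filter (d ∣ ·) =
      (Finset.range N).image (fun l => d * (l + 1)) := by
    ext k
    simp only [Finset.mem_filter, Finset.mem_Icc, Finset.mem_image, Finset.mem_range]
    constructor
    · rintro ⟨⟨h1, h2⟩, l, rfl⟩
      have hl : l ≤ N := Nat.le_of_mul_le_mul_left h2 hd0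
      have hl0 : 0 < l := Nat.pos_of_ne_zero (by rintro rfl; simp at h1)
      exact ⟨l - 1, by omega, by rw [Nat.sub_add_cancel hl0]⟩
    · rintro ⟨l, hl, rfl⟩
      exact ⟨⟨Nat.mul_pos hd0 l.succ_pos, Nat.mul_le_mul_left d hl⟩, dvd_mul_right _ _⟩
  have hinj : Set.InjOn (fun l => d * (l + 1)) (Finset.range N : Set ℕ) := by
    intro a _ b _ hab
    have := Nat.eq_of_mul_eq_mul_left hd0 hab
    omega
  have hterm (l : ℕ) : w ^ (d * (l + 1) * m) = ((w ^ d) ^ m) ^ l * (w ^ d) ^ m := by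
    rw [← pow_succ, ← pow_mul, ← pow_mul]
    congr 1
    ring
  rw [himage, Finset.sum_image hinj]
  simp only [hterm]
  rw [← Finset.sum_mul]
  split_ifs with h
  · simp [(hw'.pow_eq_one_iff_dvd m).2 h]
  · have hne : (w ^ d) ^ m ≠ 1 := fun h' => h ((hw'.pow_eq_one_iff_dvd m).1 h')
    rw [geom_sum_eq hne, ← pow_mul, mul_comm m N, pow_mul, hw'.pow_eq_one]
    simp

open ArithmeticFunction in
/-- Möbius formula for `c_n(m)`, where only divisors of an `r` with the same
prime factors as `n` are needed. -/
theorem ramanujanSum_eq_sum_moebius {n r : ℕ} (hn : 0 < n) (hr : r ∣ n)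
    (hcop : ∀ k, Nat.Coprime k n ↔ Nat.Coprime k r) (m : ℕ) :
    ramanujanSum n m =
      ∑ d ∈ r.divisors, (moebius d : ℂ) * (if n / d ∣ m then ((n / d : ℕ) : ℂ) else 0) := by
  have hr0 : r ≠ 0 := (Nat.pos_of_dvd_of_pos hr hn).ne'
  have hw := Complex.isPrimitiveRoot_exp n hn.ne'
  set w := Complex.exp (2 * Real.pi * Complex.I / n) with hwdef
  have hterm (k : ℕ) : Complex.exp (2 * Real.pi * Complex.I * k * m / n) = w ^ (k * m) := by
    rw [hwdef, ← Complex.exp_nat_mul]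
    congr 1
    push_cast
    ring
  have hind (k : ℕ) : (if Nat.Coprime k n then w ^ (k * m) else 0) =
      ∑ d ∈ r.divisors, if d ∣ k then (moebius d : ℂ) * w ^ (k * m) else 0 := by
    have h := congrArg (Int.cast : ℤ → ℂ) (sum_moebius_divisors_filter_dvd k hr0)
    rw [← Finset.sum_filter, ← Finset.sum_mul, ← Int.cast_sum, h]
    simp [hcop]
  unfold ramanujanSum
  simp only [hterm]
  rw [Finset.sum_filter]
  simp only [hind]
  rw [Finset.sum_comm]
  refine Finset.sum_congr rfl fun d hd => ?_
  rw [← hw.sum_pow_mul_filter_dvd hn ((Nat.dvd_of_mem_divisors hd).trans hr), Finset.mul_sum,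
    Finset.sum_filter]

open ArithmeticFunction in
theorem ramanujanSum_ne_zero_iff {q r : ℕ} (hq : 0 < q) (hr : Squarefree r)
    (hcop : ∀ k, Nat.Coprime k (q * r) ↔ Nat.Coprime k r) (m : ℕ) :
    ramanujanSum (q * r) m ≠ 0 ↔ q ∣ m := by
  have hr0 : 0 < r := Nat.pos_of_ne_zero hr.ne_zero
  rw [ramanujanSum_eq_sum_moebius (Nat.mul_pos hq hr0) (dvd_mul_left r q) hcop]
  have hdiv {d : ℕ} (hd : d ∈ r.divisors) : q * r / d = q * (r / d) :=
    Nat.mul_div_assoc _ (Nat.dvd_of_mem_divisors hd)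
  constructor
  · contrapose!
    intro hqm
    refine Finset.sum_eq_zero fun d hd => ?_
    rw [hdiv hd, if_neg fun h => hqm (dvd_of_mul_right_dvd h), mul_zero]
  · rintro ⟨j, rfl⟩
    have hsum : ∑ d ∈ r.divisors, (moebius d : ℂ) *
        (if q * r / d ∣ q * j then ((q * r / d : ℕ) : ℂ) else 0) =
        q * ((∑ e ∈ r.divisors, moebius (r / e) * (if e ∣ j then (e : ℤ) else 0) : ℤ) : ℂ) := by
      rw [← Nat.sum_div_divisors, Int.cast_sum, Finset.mul_sum]
      refine Finset.sum_congr rfl fun d hd => ?_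
      have hdr : d ∣ r := Nat.dvd_of_mem_divisors hd
      rw [hdiv (Nat.mem_divisors.2 ⟨Nat.div_dvd_of_dvd hdr, hr0.ne'⟩),
        Nat.div_div_self hdr hr0.ne']
      simp only [Nat.mul_dvd_mul_iff_left hq]
      split_ifs
      · push_cast
        ring
      · simp
    rw [hsum]
    exact mul_ne_zero (by exact_mod_cast hq.ne')
      (by exact_mod_cast sum_moebius_mul_ite_dvd_ne_zero hr j)

theorem rad_eq_radical (n : ℕ) : rad n = UniqueFactorizationMonoid.radical n :=
  Nat.radical_eq_prod_primeFactors.symm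

theorem coprime_rad_iff {n : ℕ} (hn : 0 < n) (k : ℕ) :
    Nat.Coprime k n ↔ Nat.Coprime k (rad n) := by
  rw [rad_eq_radical]
  refine ⟨fun h => h.coprime_dvd_right UniqueFactorizationMonoid.radical_dvd_self, fun h => ?_⟩
  exact (h.pow_right n).coprime_dvd_right (Nat.dvd_radical_pow_self hn.ne')

theorem card_range_filter_dvd {q : ℕ} (hq : 0 < q) (r : ℕ) :
    ((Finset.range (q * r)).filter (q ∣ ·)).card = r := by
  have himage : (Finset.range (q * r)).filter (q ∣ ·) = (Finset.range r).image (q * ·) := by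
    ext k
    simp only [Finset.mem_filter, Finset.mem_range, Finset.mem_image]
    constructor
    · rintro ⟨h, l, rfl⟩
      exact ⟨l, Nat.lt_of_mul_lt_mul_left h, rfl⟩
    · rintro ⟨l, hl, rfl⟩
      exact ⟨Nat.mul_lt_mul_of_pos_left hl hq, dvd_mul_right _ _⟩
  rw [himage, Finset.card_image_of_injective _ fun a b hab => Nat.eq_of_mul_eq_mul_left hq hab,
    Finset.card_range]

open Classical in
/-- For `R_n(x) = ∑_{m=0}^{n−1} c_n(m) x^m`: the number of nonzero coefficients of `R_n`
is `γ(n)`, and the degree of `R_n` is `n − n/γ(n)`. -/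
theorem ramanujan_polynomial_support_and_degree (n : ℕ) (hn : 0 < n) :
    ((Finset.range n).filter (fun m => ramanujanSum n m ≠ 0)).card = rad n ∧
    (∑ m ∈ Finset.range n,
        Polynomial.C (ramanujanSum n m) * Polynomial.X ^ m).natDegree = n - n / rad n := by
  obtain ⟨q, hnq⟩ : rad n ∣ n := by
    rw [rad_eq_radical]
    exact UniqueFactorizationMonoid.radical_dvd_self
  have hsq : Squarefree (rad n) := by
    rw [rad_eq_radical]
    exact UniqueFactorizationMonoid.squarefree_radical
  have hcop := coprime_rad_iff hn
  generalize rad n = r at *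
  have hnq : n = q * r := by rw [hnq, mul_comm]
  subst hnq
  have hq : 0 < q := Nat.pos_of_mul_pos_right hn
  have hr : 0 < r := Nat.pos_of_ne_zero hsq.ne_zero
  have hne := ramanujanSum_ne_zero_iff hq hsq hcop
  have hle : q ≤ q * r := Nat.le_mul_of_pos_right q hr
  constructor
  · simp only [hne]
    convert card_range_filter_dvd hq r
  · rw [Nat.mul_div_cancel _ hr]
    have hcoeff (i : ℕ) : (∑ m ∈ Finset.range (q * r),
        Polynomial.C (ramanujanSum (q * r) m) * Polynomial.X ^ m).coeff i =
        if i < q * r then ramanujanSum (q * r) i else 0 := by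
      simp [Polynomial.finsetSum_coeff, Polynomial.coeff_C_mul, Polynomial.coeff_X_pow]
    refine Polynomial.natDegree_eq_of_le_of_coeff_ne_zero ?_ ?_
    · refine Polynomial.natDegree_le_iff_coeff_eq_zero.2 fun i hi => ?_
      rw [hcoeff]
      split_ifs with hlt
      · by_contra h
        have hdvd : q ∣ q * r - i := Nat.dvd_sub (dvd_mul_right q r) ((hne i).1 h)
        have := Nat.le_of_dvd (by omega) hdvd
        omega
      · rfl
    · rw [hcoeff, if_pos (by omega)]
      exact (hne _).2 (Nat.dvd_sub (dvd_mul_right q r) dvd_rfl)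
end

section
/- Let n ≥ 2 be an integer. The rank (over ℂ) of the adjacency matrix of the unitary Cayley graph X_n equals γ(n); equivalently, the nullity of A(X_n) equals n − γ(n). -/
/-- Pulling a square matrix back along a surjection does not change its rank. -/
theorem Matrix.rank_submatrix_of_surjective {m k K : Type*} [Fintype m] [Fintype k] [Field K]
    (B : Matrix k k K) {f : m → k} (hf : Function.Surjective f) :
    (B.submatrix f f).rank = B.rank := by
  obtain ⟨s, hs⟩ := hf.hasRightInverse
  refine le_antisymm (Matrix.rank_submatrix_le B f f) ?_
  have h := Matrix.rank_submatrix_le (B.submatrix f f) s s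
  rwa [Matrix.submatrix_submatrix, hs.comp_eq_id, Matrix.submatrix_id_id] at h

/-- The matrix on `∏ i, Z i` whose entries indicate that all coordinates differ. -/
noncomputable def allDistinctMatrix {ι : Type*} [Fintype ι] (Z : ι → Type*)
    [∀ i, DecidableEq (Z i)] : Matrix (∀ i, Z i) (∀ i, Z i) ℂ :=
  Matrix.of fun x y => ∏ i, if x i = y i then 0 else 1

theorem isUnit_allDistinctMatrix {ι : Type*} [Fintype ι] [DecidableEq ι] (Z : ι → Type*)
    [∀ i, DecidableEq (Z i)] [∀ i, Fintype (Z i)] (hZ : ∀ i, 2 ≤ Fintype.card (Z i)) :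
    IsUnit (allDistinctMatrix Z) := by
  let C : Matrix (∀ i, Z i) (∀ i, Z i) ℂ := Matrix.of fun x y =>
    ∏ i, (((Fintype.card (Z i) : ℂ) - 1)⁻¹ - if x i = y i then 1 else 0)
  refine IsUnit.of_mul_eq_one C ?_
  ext x y
  have factor (i : ι) : ∑ z : Z i, (if x i = z then (0 : ℂ) else 1) *
      (((Fintype.card (Z i) : ℂ) - 1)⁻¹ - if z = y i then 1 else 0) =
      if x i = y i then 1 else 0 := by
    have hc : (Fintype.card (Z i) : ℂ) - 1 ≠ 0 := by
      have := hZ i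
      rw [sub_ne_zero]
      exact_mod_cast (show Fintype.card (Z i) ≠ 1 by omega)
    have h (z : Z i) : (if x i = z then (0 : ℂ) else 1) *
        (((Fintype.card (Z i) : ℂ) - 1)⁻¹ - if z = y i then 1 else 0) =
        ((Fintype.card (Z i) : ℂ) - 1)⁻¹ - (if z = y i then 1 else 0)
          - (if x i = z then ((Fintype.card (Z i) : ℂ) - 1)⁻¹ - (if x i = y i then 1 else 0)
            else 0) := by
      by_cases hx : x i = z
      · subst hx; simp
      · simp [hx]
    rw [Finset.sum_congr rfl fun z _ => h z]
    simp only [Finset.sum_sub_distrib, Finset.sum_ite_eq, Finset.sum_ite_eq', Finset.mem_univ,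
      if_true, Finset.sum_const, Finset.card_univ, nsmul_eq_mul]
    field_simp
    ring
  simp only [Matrix.mul_apply, allDistinctMatrix, C, Matrix.of_apply, ← Finset.prod_mul_distrib]
  rw [← Fintype.piFinset_univ, ← Finset.prod_univ_sum (fun i => (Finset.univ : Finset (Z i)))
    (fun i z => (if x i = z then (0 : ℂ) else 1) *
      (((Fintype.card (Z i) : ℂ) - 1)⁻¹ - if z = y i then 1 else 0)),
    Finset.prod_congr rfl fun i _ => factor i]
  simp [Matrix.one_apply, Finset.prod_ite_zero, funext_iff]

/-- Reduction of a residue modulo `n` at every prime divisor of `n`. -/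
def residues (n : ℕ) (x : ZMod n) (p : n.primeFactors) : ZMod p :=
  ZMod.castHom (Nat.dvd_of_mem_primeFactors p.2) (ZMod p) x

theorem residues_surjective (n : ℕ) : Function.Surjective (residues n) := by
  intro v
  have hp (p : n.primeFactors) : (p : ℕ).Prime := Nat.prime_of_mem_primeFactors p.2
  have (p : n.primeFactors) : NeZero (p : ℕ) := ⟨(hp p).ne_zero⟩
  obtain ⟨k, hk⟩ := Nat.chineseRemainderOfFinset (fun p : n.primeFactors => (v p).val)
    (fun p => (p : ℕ)) Finset.univ (fun p _ => (hp p).ne_zero)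
    (fun p _ q _ hpq => (Nat.coprime_primes (hp p) (hp q)).2 fun h => hpq (Subtype.ext h))
  refine ⟨(k : ZMod n), funext fun p => ?_⟩
  have := (ZMod.natCast_eq_natCast_iff _ _ _).2 (hk p (Finset.mem_univ p))
  simpa [residues] using this

theorem isUnit_iff_residues_ne {n : ℕ} [NeZero n] (x y : ZMod n) :
    IsUnit (x - y) ↔ ∀ p, residues n x p ≠ residues n y p := by
  have h (p : n.primeFactors) : residues n x p = residues n y p ↔ (p : ℕ) ∣ (x - y).val := by
    rw [← sub_eq_zero, ← ZMod.natCast_eq_zero_iff, residues, residues, ← map_sub]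
    simp [ZMod.natCast_val]
  rw [← ZMod.natCast_zmod_val (x - y), ZMod.isUnit_iff_coprime]
  simp only [ne_eq, h]
  constructor
  · intro hc p hd
    exact Nat.not_coprime_of_dvd_of_dvd (Nat.prime_of_mem_primeFactors p.2).one_lt hd
      (Nat.dvd_of_mem_primeFactors p.2) hc
  · exact fun hd => Nat.coprime_of_dvd fun p hp hx hn =>
      hd ⟨p, Nat.mem_primeFactors.2 ⟨hp, hn, NeZero.ne n⟩⟩ hx

theorem ucgAdjMatrix_eq_submatrix {n : ℕ} [NeZero n] (hn : 2 ≤ n) :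
    ucgAdjMatrix n =
      (allDistinctMatrix fun p : n.primeFactors => ZMod p).submatrix (residues n) (residues n) := by
  have : Fact (1 < n) := ⟨hn⟩
  ext x y
  have h : (x ≠ y ∧ IsUnit (x - y)) ↔ ∀ p, residues n x p ≠ residues n y p := by
    rw [← isUnit_iff_residues_ne, and_iff_right_iff_imp]
    rintro hu rfl
    simp at hu
  simp only [ucgAdjMatrix, allDistinctMatrix, Matrix.of_apply, Matrix.submatrix_apply, h]
  split_ifs with hd
  · simp [hd]
  · push Not at hd
    obtain ⟨p, hp⟩ := hd
    rw [eq_comm]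
    exact Finset.prod_eq_zero (Finset.mem_univ p) (if_pos hp)

/-- The rank of the adjacency matrix of `X_n` equals `γ(n)`; equivalently its nullity
equals `n − γ(n)`. -/
theorem ucg_rank_eq_radical (n : ℕ) [NeZero n] (hn : 2 ≤ n) :
    (ucgAdjMatrix n).rank = rad n ∧
    Module.finrank ℂ (LinearMap.ker (ucgAdjMatrix n).mulVecLin) = n - rad n := by
  have hp (p : n.primeFactors) : (p : ℕ).Prime := Nat.prime_of_mem_primeFactors p.2
  have (p : n.primeFactors) : NeZero (p : ℕ) := ⟨(hp p).ne_zero⟩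
  have hrank : (ucgAdjMatrix n).rank = rad n := by
    rw [ucgAdjMatrix_eq_submatrix hn, Matrix.rank_submatrix_of_surjective _ (residues_surjective n),
      Matrix.rank_of_isUnit _ (isUnit_allDistinctMatrix _ fun p => ?_)]
    · simp only [Fintype.card_pi, ZMod.card, rad]
      exact Finset.prod_coe_sort n.primeFactors fun p => p
    · simpa using (hp p).two_le
  refine ⟨hrank, ?_⟩
  have hsum := LinearMap.finrank_range_add_finrank_ker (ucgAdjMatrix n).mulVecLin
  rw [Module.finrank_fintype_fun_eq_card, ZMod.card, ← Matrix.rank, hrank] at hsum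
  omega
end

section
/- Let n ≥ 2 be an integer. Every eigenvalue of the adjacency matrix of the unitary Cayley graph X_n is an integer, and every nonzero eigenvalue of A(X_n) divides φ(n) (as an integer). In particular, if n is not squarefree, then neither 1 nor −1 is an eigenvalue of A(X_n). -/
open Finset in
/-- The sum of the primitive `n`-th roots of unity in `ℂ` is `μ n`. -/
theorem sum_primitiveRoots_eq_moebius {n : ℕ} (hn : 0 < n) :
    ∑ ζ ∈ primitiveRoots n ℂ, ζ = (ArithmeticFunction.moebius n : ℂ) := by
  have sum_divisors : ∀ m > 0,
      ∑ d ∈ m.divisors, ∑ ζ ∈ primitiveRoots d ℂ, ζ = if m = 1 then (1 : ℂ) else 0 := by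
    intro m hm
    have : NeZero m := ⟨hm.ne'⟩
    have hζ := Complex.isPrimitiveRoot_exp m hm.ne'
    rw [← sum_biUnion fun i _ j _ hij => IsPrimitiveRoot.disjoint hij,
      ← IsPrimitiveRoot.nthRoots_one_eq_biUnion_primitiveRoots]
    have hsum : ∑ ζ ∈ Polynomial.nthRootsFinset m (1 : ℂ), ζ =
        ∑ i ∈ range m, Complex.exp (2 * Real.pi * Complex.I / m) ^ i := by
      symm
      refine sum_nbij (fun i => Complex.exp (2 * Real.pi * Complex.I / m) ^ i) ?_ ?_ ?_ ?_
      · intro i _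
        rw [Polynomial.mem_nthRootsFinset hm, pow_right_comm, hζ.pow_eq_one, one_pow]
      · intro i hi j hj h
        exact hζ.pow_inj (by simpa using hi) (by simpa using hj) h
      · intro ξ hξ
        rw [mem_coe, Polynomial.mem_nthRootsFinset hm] at hξ
        obtain ⟨i, hi, h⟩ := hζ.eq_pow_of_pow_eq_one hξ
        exact ⟨i, by simpa using hi, h⟩
      · intro i _
        rfl
    rw [hsum]
    split_ifs with h
    · subst h
      simp
    · exact hζ.geom_sum_eq_zero (by omega)
  rw [← ArithmeticFunction.sum_eq_iff_sum_mul_moebius_eq.mp sum_divisors n hn,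
    sum_eq_single (n, 1)]
  · simp
  · rintro ⟨a, b⟩ hab hne
    have hb : b ≠ 1 := by
      rintro rfl
      simp_all
    simp [hb]
  · intro h
    simp [hn.ne'] at h

theorem IsPrimitiveRoot.sum_units_pow_eq_moebius {d : ℕ} [NeZero d] {ζ : ℂ}
    (hζ : IsPrimitiveRoot ζ d) :
    ∑ u : (ZMod d)ˣ, ζ ^ (u : ZMod d).val = (ArithmeticFunction.moebius d : ℂ) := by
  rw [← sum_primitiveRoots_eq_moebius (NeZero.pos d)]
  refine Finset.sum_nbij (fun u => ζ ^ (u : ZMod d).val) ?_ ?_ ?_ fun _ _ => rfl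
  · intro u _
    rw [mem_primitiveRoots (NeZero.pos d)]
    exact hζ.pow_of_coprime _ (ZMod.val_coe_unit_coprime u)
  · intro u _ v _ h
    exact Units.ext (ZMod.val_injective d (hζ.pow_inj (ZMod.val_lt _) (ZMod.val_lt _) h))
  · intro ξ hξ
    rw [Finset.mem_coe, mem_primitiveRoots (NeZero.pos d), hζ.isPrimitiveRoot_iff] at hξ
    obtain ⟨i, hi, hid, h⟩ := hξ
    refine ⟨ZMod.unitOfCoprime i hid, by simp, ?_⟩
    simpa [ZMod.val_cast_of_lt hi] using h

theorem MonoidHom.sum_comp_of_surjective {G H R : Type*} [Group G] [Group H] [Fintype G]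
    [Fintype H] [Semiring R] (f : G →* H) (hf : Function.Surjective f) (g : H → R) :
    ∑ x, g (f x) = (Nat.card f.ker : R) * ∑ y, g y := by
  classical
  rw [← Finset.sum_fiberwise Finset.univ f, Finset.mul_sum]
  refine Finset.sum_congr rfl fun y _ => ?_
  have hcard : (Finset.univ.filter fun x => f x = y).card = Nat.card f.ker := by
    obtain ⟨x₀, rfl⟩ := hf y
    rw [← Nat.card_congr (f.fiberEquivKer x₀), Nat.card_eq_fintype_card, ← Set.toFinset_card]
    congr 1
    ext
    simp
  rw [Finset.sum_congr rfl fun x hx => by rw [(Finset.mem_filter.mp hx).2], Finset.sum_const,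
    hcard, nsmul_eq_mul]

/-- Hölder's evaluation of the Ramanujan sum. -/
theorem IsPrimitiveRoot.exists_sum_units_pow_eq {n d : ℕ} [NeZero n] (hd : d ∣ n) {ζ : ℂ}
    (hζ : IsPrimitiveRoot ζ d) :
    ∃ c : ℕ, n.totient = c * d.totient ∧
      ∑ u : (ZMod n)ˣ, ζ ^ (u : ZMod n).val = ((c * ArithmeticFunction.moebius d : ℤ) : ℂ) := by
  have : NeZero d := ⟨fun h => NeZero.ne n (Nat.eq_zero_of_zero_dvd (h ▸ hd))⟩
  have key := fun g : (ZMod d)ˣ → ℂ =>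
    (ZMod.unitsMap hd).sum_comp_of_surjective (ZMod.unitsMap_surjective hd) g
  refine ⟨Nat.card (ZMod.unitsMap hd).ker, ?_, ?_⟩
  · have h := key 1
    simp only [Pi.one_apply, Finset.sum_const, Finset.card_univ, ZMod.card_units_eq_totient,
      nsmul_eq_mul, mul_one] at h
    exact_mod_cast h
  · have h := key fun w => ζ ^ (w : ZMod d).val
    rw [hζ.sum_units_pow_eq_moebius] at h
    push_cast
    rw [← h]
    refine Finset.sum_congr rfl fun u _ => ?_
    rw [ZMod.unitsMap_val, ZMod.cast_eq_val, ZMod.val_natCast]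
    nth_rw 1 [← Nat.mod_add_div (u : ZMod n).val d]
    rw [pow_add, pow_mul, hζ.pow_eq_one, one_pow, mul_one]

open ZMod in
/-- Every eigenvalue of `X_n` is the sum over the units of an additive character. -/
theorem exists_eq_sum_units_of_mem_spectrum_ucgAdjMatrix {n : ℕ} [NeZero n] (hn : 2 ≤ n) {lam : ℂ}
    (h : lam ∈ spectrum ℂ (ucgAdjMatrix n)) :
    ∃ k : ZMod n, lam = ∑ u : (ZMod n)ˣ, stdAddChar ((u : ZMod n) * k) := by
  classical
  have : Nontrivial (ZMod n) := ZMod.nontrivial_iff.mpr (by omega)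
  rw [← Matrix.spectrum_toLin', ← Module.End.hasEigenvalue_iff_mem_spectrum] at h
  obtain ⟨v, hv⟩ := h.exists_hasEigenvector
  have hmul : (ucgAdjMatrix n).mulVec v = lam • v := by
    simpa using hv.apply_eq_smul
  have hmul_apply (x : ZMod n) : ∑ u : (ZMod n)ˣ, v (x - u) = lam * v x := by
    rw [← smul_eq_mul, ← Pi.smul_apply, ← hmul]
    simp only [Matrix.mulVec, dotProduct, ucgAdjMatrix, Matrix.of_apply, ite_mul, one_mul, zero_mul]
    rw [← Finset.sum_filter]
    refine Finset.sum_nbij (fun u => x - u) ?_ ?_ ?_ fun _ _ => rfl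
    · intro u _
      simp [eq_comm (a := x)]
    · intro u _ w _ huw
      exact Units.ext (by simpa using huw)
    · intro y hy
      obtain ⟨u, hu⟩ := (by simpa using hy : ¬x = y ∧ IsUnit (x - y)).2
      exact ⟨u, by simp, by simp [hu]⟩
  obtain ⟨k, hk⟩ : ∃ k, 𝓕 v k ≠ 0 := by
    by_contra! hzero
    exact hv.2 (dft.map_eq_zero_iff.mp (funext hzero))
  refine ⟨-k, mul_right_cancel₀ hk ?_⟩
  simp only [dft_apply, smul_eq_mul]
  calc lam * ∑ x, stdAddChar (-(x * k)) * v x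
      = ∑ x, ∑ u : (ZMod n)ˣ, stdAddChar (-(x * k)) * v (x - u) := by
        simp_rw [← Finset.mul_sum, hmul_apply, Finset.mul_sum, mul_left_comm]
    _ = ∑ u : (ZMod n)ˣ, ∑ x, stdAddChar (-(x * k)) * v (x - u) := Finset.sum_comm
    _ = (∑ u : (ZMod n)ˣ, stdAddChar ((u : ZMod n) * -k)) * ∑ x, stdAddChar (-(x * k)) * v x := by
        rw [Finset.sum_mul]
        refine Finset.sum_congr rfl fun u _ => ?_
        rw [← Equiv.sum_comp (Equiv.addRight (u : ZMod n)), Finset.mul_sum]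
        refine Finset.sum_congr rfl fun x _ => ?_
        rw [Equiv.coe_addRight, add_sub_cancel_right, ← mul_assoc, ← AddChar.map_add_eq_mul]
        congr 2
        ring

/-- Every eigenvalue of `X_n` has the form `(φ(n) / φ(d)) μ(d)` for a divisor `d` of `n`. -/
theorem exists_eq_mul_moebius_of_mem_spectrum_ucgAdjMatrix {n : ℕ} [NeZero n] (hn : 2 ≤ n)
    {lam : ℂ} (h : lam ∈ spectrum ℂ (ucgAdjMatrix n)) :
    ∃ d c : ℕ, d ∣ n ∧ n.totient = c * d.totient ∧
      lam = ((c * ArithmeticFunction.moebius d : ℤ) : ℂ) := by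
  obtain ⟨k, rfl⟩ := exists_eq_sum_units_of_mem_spectrum_ucgAdjMatrix hn h
  have hpow : ∀ u : ZMod n, ZMod.stdAddChar (u * k) = (ZMod.stdAddChar k : ℂ) ^ u.val := by
    intro u
    rw [← AddChar.map_nsmul_eq_pow, nsmul_eq_mul, ZMod.natCast_zmod_val]
  have hd : orderOf (ZMod.stdAddChar k : ℂ) ∣ n := by
    refine orderOf_dvd_of_pow_eq_one ?_
    rw [← AddChar.map_nsmul_eq_pow, nsmul_eq_mul, ZMod.natCast_self, zero_mul,
      AddChar.map_zero_eq_one]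
  obtain ⟨c, hc, hsum⟩ :=
    (IsPrimitiveRoot.orderOf (ZMod.stdAddChar k : ℂ)).exists_sum_units_pow_eq hd
  exact ⟨_, c, hd, hc, by simpa only [hpow] using hsum⟩

theorem Nat.squarefree_of_totient_eq {d n : ℕ} (hdn : d ∣ n) (hd : Squarefree d)
    (h : d.totient = n.totient) : Squarefree n := by
  obtain rfl | rfl := Nat.eq_or_eq_of_totient_eq_totient hdn h
  · exact hd
  · obtain hodd | heven := (Nat.even_or_odd d).symm
    · exact (Nat.squarefree_mul (Nat.coprime_two_left.mpr hodd)).mpr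
        ⟨Nat.prime_two.prime.squarefree, hd⟩
    · rwa [← heven.eq_of_totient_eq_totient hdn h]

/-- Every eigenvalue of `X_n` is an integer, every nonzero eigenvalue divides `φ(n)`, and if
`n` is not squarefree then neither `1` nor `−1` is an eigenvalue of `X_n`. -/
theorem ucg_eigenvalues_integral_dvd_totient (n : ℕ) [NeZero n] (hn : 2 ≤ n) :
    (∀ lam ∈ spectrum ℂ (ucgAdjMatrix n),
      ∃ z : ℤ, lam = (z : ℂ) ∧ (lam ≠ 0 → z ∣ (Nat.totient n : ℤ))) ∧
    (¬ Squarefree n →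
      (1 : ℂ) ∉ spectrum ℂ (ucgAdjMatrix n) ∧ (-1 : ℂ) ∉ spectrum ℂ (ucgAdjMatrix n)) := by
  refine ⟨fun lam hlam => ?_, fun hsq => ?_⟩
  · obtain ⟨d, c, -, hc, rfl⟩ := exists_eq_mul_moebius_of_mem_spectrum_ucgAdjMatrix hn hlam
    refine ⟨_, rfl, fun hne => ?_⟩
    have hμ : ArithmeticFunction.moebius d ≠ 0 := by
      rintro h
      simp [h] at hne
    rw [hc]
    push_cast
    refine mul_dvd_mul_left _ ?_
    rcases ArithmeticFunction.moebius_ne_zero_iff_eq_or.mp hμ with h | h <;> simp [h]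
  · have not_mem : ∀ z : ℤ, IsUnit z → (z : ℂ) ∉ spectrum ℂ (ucgAdjMatrix n) := by
      intro z hz hmem
      obtain ⟨d, c, hd, hc, h⟩ := exists_eq_mul_moebius_of_mem_spectrum_ucgAdjMatrix hn hmem
      rw [Int.cast_inj.mp h, IsUnit.mul_iff] at hz
      have hc1 : c = 1 := by simpa [Int.isUnit_iff] using hz.1
      refine hsq (Nat.squarefree_of_totient_eq hd
        (ArithmeticFunction.moebius_ne_zero_iff_squarefree.mp hz.2.ne_zero) ?_)
      rw [hc, hc1, one_mul]
    exact ⟨by simpa using not_mem 1 isUnit_one, by simpa using not_mem (-1) isUnit_one.neg⟩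
end

section
/- Let n ≥ 2 be an integer. The unitary Cayley graph X_n is strongly regular (i.e., there exist parameters k, ℓ, μ such that X_n is strongly regular with parameters (n, k, ℓ, μ)) if and only if n is a prime power. -/
/-- The unitary Cayley graph `X_n`: vertices are `ℤ/nℤ`, and distinct `x, y` are adjacent
iff `x − y` is a unit of `ℤ/nℤ`. -/
def unitaryCayley (n : ℕ) : SimpleGraph (ZMod n) :=
  SimpleGraph.fromRel (fun x y => IsUnit (x - y))

theorem unitaryCayley_adj {n : ℕ} (hn : 2 ≤ n) (x y : ZMod n) :
    (unitaryCayley n).Adj x y ↔ IsUnit (y - x) := by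
  have : Fact (1 < n) := ⟨hn⟩
  rw [unitaryCayley, SimpleGraph.fromRel_adj, ← neg_sub y x, IsUnit.neg_iff, or_self,
    and_iff_right_iff_imp]
  rintro h rfl
  simp at h

/-- The neighbors of `v` correspond to the units, by translation. -/
theorem card_neighborSet_unitaryCayley {n : ℕ} (hn : 2 ≤ n) (v : ZMod n) :
    Nat.card ((unitaryCayley n).neighborSet v) = Nat.card (ZMod n)ˣ := by
  symm
  refine Nat.card_congr (Equiv.ofBijective
    (fun u => ⟨v + u, by simp [unitaryCayley_adj hn]⟩) ⟨fun a b h => ?_, fun ⟨y, hy⟩ => ?_⟩)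
  · simpa [Units.ext_iff] using h
  · obtain ⟨u, hu⟩ := (unitaryCayley_adj hn v y).1 hy
    exact ⟨u, by simp [hu]⟩

/-- The common neighbors of `v` and `w` correspond to the units `u` such that `u - (w - v)` is
a unit, by translation. -/
theorem card_commonNeighbors_unitaryCayley {n : ℕ} (hn : 2 ≤ n) (v w : ZMod n) :
    Nat.card ((unitaryCayley n).commonNeighbors v w) =
      Nat.card {u : (ZMod n)ˣ // IsUnit ((u : ZMod n) - (w - v))} := by
  symm
  refine Nat.card_congr (Equiv.ofBijective
    (fun u => ⟨v + u.1, ?_⟩) ⟨fun a b h => ?_, fun ⟨y, hy⟩ => ?_⟩)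
  · rw [SimpleGraph.mem_commonNeighbors, unitaryCayley_adj hn, unitaryCayley_adj hn]
    refine ⟨by simp, ?_⟩
    convert u.2 using 1
    ring
  · simpa [Units.ext_iff, Subtype.ext_iff] using h
  · rw [SimpleGraph.mem_commonNeighbors, unitaryCayley_adj hn, unitaryCayley_adj hn] at hy
    obtain ⟨⟨u, hu⟩, h⟩ := hy
    refine ⟨⟨u, ?_⟩, by simp [hu]⟩
    convert h using 1
    rw [hu]
    ring

/-- Rescaling by a unit does not change the number of units `u` with `u - x` a unit. -/
theorem card_units_sub_unit {R : Type*} [CommRing R] (x : Rˣ) :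
    Nat.card {u : Rˣ // IsUnit ((u : R) - x)} = Nat.card {u : Rˣ // IsUnit ((u : R) - 1)} := by
  refine Nat.card_congr ((Equiv.mulRight x⁻¹).subtypeEquiv fun u => ?_)
  have : (((Equiv.mulRight x⁻¹) u : Rˣ) : R) - 1 = (u - x) * (x⁻¹ : Rˣ) := by
    simp [sub_mul]
  rw [this, Units.isUnit_mul_units]

theorem ZMod.isUnit_iff_castHom_ne_zero {n : ℕ} [NeZero n] (a : ZMod n) :
    IsUnit a ↔ ∀ (q : ℕ) (hq : q ∣ n), q.Prime → ZMod.castHom hq (ZMod q) a ≠ 0 := by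
  obtain ⟨a, rfl⟩ := ZMod.natCast_zmod_surjective a
  simp only [map_natCast, ne_eq, ZMod.natCast_eq_zero_iff, ZMod.isUnit_iff_coprime]
  refine ⟨fun h q hq hp ha => hp.one_lt.ne' (Nat.eq_one_of_dvd_coprimes h ha hq), fun h => ?_⟩
  by_contra hc
  obtain ⟨q, hp, ha, hq⟩ := Nat.Prime.not_coprime_iff_dvd.1 hc
  exact h q hq hp ha

/-- If `x` vanishes modulo all prime divisors of `n` except `p`, then exactly a `1 / (p - 1)`
fraction of the units `u` have `u - x` not a unit. -/
theorem card_units_sub_not_isUnit {n p : ℕ} [NeZero n] (hp : p.Prime) (hpn : p ∣ n) {x : ZMod n}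
    (hx : ZMod.castHom hpn (ZMod p) x ≠ 0)
    (hx' : ∀ (q : ℕ) (hq : q ∣ n), q.Prime → q ≠ p → ZMod.castHom hq (ZMod q) x = 0) :
    Nat.card {u : (ZMod n)ˣ // ¬ IsUnit ((u : ZMod n) - x)} * (p - 1) = Nat.card (ZMod n)ˣ := by
  have : Fact p.Prime := ⟨hp⟩
  have hs : Function.Surjective (ZMod.unitsMap hpn) := ZMod.unitsMap_surjective hpn
  obtain ⟨a, ha⟩ := hs (Units.mk0 _ hx)
  have key (u : (ZMod n)ˣ) :
      ¬ IsUnit ((u : ZMod n) - x) ↔ a⁻¹ * u ∈ (ZMod.unitsMap hpn).ker := by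
    rw [MonoidHom.mem_ker, map_mul, map_inv, ha, inv_mul_eq_one, eq_comm, Units.ext_iff,
      Units.val_mk0, ZMod.isUnit_iff_castHom_ne_zero]
    change _ ↔ ZMod.castHom hpn (ZMod p) (u : ZMod n) = _
    push Not
    constructor
    · rintro ⟨q, hq, hqp, h⟩
      obtain rfl | hne := eq_or_ne q p
      · rwa [map_sub, sub_eq_zero] at h
      · rw [map_sub, hx' q hq hqp hne, sub_zero] at h
        exact absurd h ((ZMod.isUnit_iff_castHom_ne_zero _).1 u.isUnit q hq hqp)
    · intro h
      exact ⟨p, hpn, hp, by rw [map_sub, h, sub_self]⟩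
  rw [Nat.card_congr ((Equiv.mulLeft a⁻¹).subtypeEquiv key),
    ← Subgroup.card_mul_index (ZMod.unitsMap hpn).ker, Subgroup.index_ker,
    MonoidHom.range_eq_top.2 hs, Subgroup.card_top, Nat.card_eq_fintype_card (α := (ZMod p)ˣ),
    ZMod.card_units]

/-- For distinct primes `p, q ∣ n` there is a non-neighbor `x ≠ 0` of `0` whose number of common
neighbors with `0` is `φ(n) (1 - 1 / (p - 1))`. -/
theorem exists_nonadj_unitaryCayley {n p q : ℕ} [NeZero n] (hn : 2 ≤ n) (hp : p.Prime)
    (hq : q.Prime) (hpq : p ≠ q) (hpn : p ∣ n) (hqn : q ∣ n) :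
    ∃ (x : ZMod n) (N : ℕ), 0 ≠ x ∧ ¬ (unitaryCayley n).Adj 0 x ∧
      Nat.card ((unitaryCayley n).commonNeighbors 0 x) + N = Nat.card (ZMod n)ˣ ∧
      N * (p - 1) = Nat.card (ZMod n)ˣ := by
  have hn0 : n ≠ 0 := NeZero.ne n
  have hx : ZMod.castHom hpn (ZMod p) ((n / p ^ n.factorization p : ℕ) : ZMod n) ≠ 0 := by
    rw [map_natCast, ne_eq, ZMod.natCast_eq_zero_iff]
    exact Nat.not_dvd_ordCompl hp hn0
  have hx' (r : ℕ) (hr : r ∣ n) (hrp : r.Prime) (hne : r ≠ p) :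
      ZMod.castHom hr (ZMod r) ((n / p ^ n.factorization p : ℕ) : ZMod n) = 0 := by
    rw [map_natCast, ZMod.natCast_eq_zero_iff]
    exact Nat.dvd_ordCompl_of_dvd_not_dvd hr fun h =>
      hne ((Nat.prime_dvd_prime_iff_eq hp hrp).1 h).symm
  refine ⟨((n / p ^ n.factorization p : ℕ) : ZMod n), _, ?_, ?_, ?_,
    card_units_sub_not_isUnit hp hpn hx hx'⟩
  · intro h
    rw [← h, map_zero] at hx
    exact hx rfl
  · rw [unitaryCayley_adj hn, sub_zero, ZMod.isUnit_iff_castHom_ne_zero]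
    exact fun h => h q hqn hq (hx' q hqn hq hpq.symm)
  · rw [card_commonNeighbors_unitaryCayley hn, sub_zero, ← Nat.card_sum]
    classical exact Nat.card_congr (Equiv.sumCompl _)

theorem ZMod.isNilpotent_of_not_isUnit_of_isPrimePow {n : ℕ} (hn : IsPrimePow n) {a : ZMod n}
    (ha : ¬ IsUnit a) : IsNilpotent a := by
  have : NeZero n := ⟨hn.ne_zero⟩
  obtain ⟨p, k, hp, -, rfl⟩ := (isPrimePow_nat_iff n).1 hn
  obtain ⟨a, rfl⟩ := ZMod.natCast_zmod_surjective a
  rw [ZMod.isUnit_iff_coprime] at ha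
  have hpa : p ∣ a := by
    by_contra h
    exact ha ((hp.coprime_iff_not_dvd.2 h).symm.pow_right k)
  refine ⟨k, ?_⟩
  rw [← Nat.cast_pow, ZMod.natCast_eq_zero_iff]
  exact pow_dvd_pow_of_dvd hpa k

open Classical in
/-- `X_n` is strongly regular (for some parameters `(n, k, ℓ, μ)`) iff `n` is a prime power. -/
theorem ucg_strongly_regular_iff_prime_pow (n : ℕ) [NeZero n] (hn : 2 ≤ n) :
    (∃ k ℓ μ : ℕ, (unitaryCayley n).IsSRGWith n k ℓ μ) ↔ IsPrimePow n := by
  constructor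
  · rintro ⟨k, ℓ, μ, h⟩
    obtain ⟨p, hp, hpn⟩ := Nat.exists_prime_and_dvd (show n ≠ 1 by lia)
    refine (isPrimePow_iff_unique_prime_dvd).2 ⟨p, ⟨hp, hpn⟩, fun q ⟨hq, hqn⟩ => ?_⟩
    by_contra hqp
    obtain ⟨x, N, hx0, hx, hxN, hN⟩ :=
      exists_nonadj_unitaryCayley hn hp hq (Ne.symm hqp) hpn hqn
    obtain ⟨y, M, hy0, hy, hyM, hM⟩ := exists_nonadj_unitaryCayley hn hq hp hqp hqn hpn
    have hcx := h.of_not_adj hx0 hx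
    have hcy := h.of_not_adj hy0 hy
    rw [← Nat.card_eq_fintype_card] at hcx hcy
    obtain rfl : N = M := by lia
    have hpos : 0 < Nat.card (ZMod n)ˣ := Nat.card_pos
    have hNpos : 0 < N := Nat.pos_of_ne_zero fun h0 => by simp [h0] at hN; lia
    have := Nat.eq_of_mul_eq_mul_left hNpos (hN.trans hM.symm)
    have := hp.two_le
    have := hq.two_le
    lia
  · intro h
    refine ⟨Nat.card (ZMod n)ˣ, Nat.card {u : (ZMod n)ˣ // IsUnit ((u : ZMod n) - 1)},
      Nat.card (ZMod n)ˣ, ZMod.card n, fun v => ?_, fun v w hvw => ?_, fun v w _ hvw => ?_⟩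
    · rw [← SimpleGraph.card_neighborSet_eq_degree, ← Nat.card_eq_fintype_card,
        card_neighborSet_unitaryCayley hn]
    · obtain ⟨u, hu⟩ := (unitaryCayley_adj hn v w).1 hvw
      rw [← Nat.card_eq_fintype_card, card_commonNeighbors_unitaryCayley hn, ← hu,
        card_units_sub_unit]
    · rw [unitaryCayley_adj hn] at hvw
      have hnil := ZMod.isNilpotent_of_not_isUnit_of_isPrimePow h hvw
      rw [← Nat.card_eq_fintype_card, card_commonNeighbors_unitaryCayley hn]
      refine Nat.card_congr (Equiv.subtypeUnivEquiv fun u => ?_)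
      rw [sub_eq_add_neg]
      exact hnil.neg.isUnit_add_left_of_commute u.isUnit (Commute.all _ _)
end
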